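/- Let f and g be transcendental entire functions. Then the composite function f ∘ g has infinitely many fixed points; that is, the set {z ∈ ℂ : f(g(z)) = z} is infinite. -/

import Mathlib

section
open Complex Metric Set

/-- A zero-free holomorphic function on a disc has a holomorphic logarithm. -/
lemma exists_log_on_ball {h : ℂ → ℂ} {c : ℂ} {R : ℝ} (hh : DifferentiableOn ℂ h (ball c R))
    (h0 : ∀ z ∈ ball c R, h z ≠ 0) :
    ∃ l : ℂ → ℂ, DifferentiableOn ℂ l (ball c R) ∧ ∀ z ∈ ball c R, exp (l z) = h z := by
  rcases le_or_gt R 0 with hR | hR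
  · refine ⟨fun _ => 0, by fun_prop, fun z hz => ?_⟩
    simp [ball_eq_empty.2 hR] at hz
  have hd : DifferentiableOn ℂ (fun z => deriv h z / h z) (ball c R) :=
    (hh.deriv isOpen_ball).div hh h0
  have hc : c ∈ ball c R := mem_ball_self hR
  obtain ⟨l, hl0, hl⟩ := (hd.isExactOn_ball).with_val_at c (Complex.log (h c))
  have hld : DifferentiableOn ℂ l (ball c R) :=
    fun z hz => (hl z hz).differentiableAt.differentiableWithinAt
  refine ⟨l, hld, ?_⟩
  have key : ∀ z ∈ ball c R, h z * exp (-l z) = h c * exp (-l c) := by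
    have hder : ∀ z ∈ ball c R, HasDerivAt (fun z => h z * exp (-l z)) 0 z := by
      intro z hz
      have h1 : HasDerivAt h (deriv h z) z :=
        ((hh z hz).differentiableAt (isOpen_ball.mem_nhds hz)).hasDerivAt
      have h2 := h1.mul ((hl z hz).neg.cexp)
      have e : h z * (deriv h z / h z) = deriv h z := mul_div_cancel₀ _ (h0 z hz)
      exact h2.congr_deriv (by linear_combination -exp (-l z) * e)
    intro z hz
    refine isOpen_ball.is_const_of_deriv_eq_zero (convex_ball c R).isPreconnected
      (f := fun z => h z * exp (-l z)) ?_ ?_ hz hc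
    · exact fun z hz => (hder z hz).differentiableAt.differentiableWithinAt
    · exact fun z hz => (hder z hz).deriv
  intro z hz
  have := key z hz
  rw [hl0, exp_neg, exp_neg, exp_log (h0 c hc), mul_inv_cancel₀ (h0 c hc)] at this
  field_simp at this
  exact this.symm

lemma exists_cos_on_ball {h : ℂ → ℂ} {c : ℂ} {R : ℝ} (hh : DifferentiableOn ℂ h (ball c R))
    (h1 : ∀ z ∈ ball c R, h z ≠ 1) (h2 : ∀ z ∈ ball c R, h z ≠ -1) :
    ∃ F : ℂ → ℂ, DifferentiableOn ℂ F (ball c R) ∧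
      ∀ z ∈ ball c R, Complex.cos (Real.pi * F z) = h z := by
  obtain ⟨l, hl, hle⟩ := exists_log_on_ball (h := fun z => 1 - h z ^ 2) (c := c) (R := R)
    (by fun_prop) (by
      intro z hz e
      have : (h z - 1) * (h z + 1) = 0 := by linear_combination -e
      rcases mul_eq_zero.1 this with e | e
      · exact h1 z hz (by linear_combination e)
      · exact h2 z hz (by linear_combination e))
  have hk : ∀ z ∈ ball c R, exp (l z / 2) ^ 2 = 1 - h z ^ 2 := by
    intro z hz
    rw [← hle z hz, ← exp_nat_mul]; congr 1; push_cast; ring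
  have hprod : ∀ z ∈ ball c R, (h z + I * exp (l z / 2)) * (h z - I * exp (l z / 2)) = 1 := by
    intro z hz
    linear_combination hk z hz - exp (l z / 2) ^ 2 * I_sq
  obtain ⟨m, hm, hme⟩ := exists_log_on_ball (h := fun z => h z + I * exp (l z / 2)) (c := c) (R := R)
    (by fun_prop) (by
      intro z hz e
      have := hprod z hz
      have e' : h z + I * exp (l z / 2) = 0 := e
      rw [e'] at this; simp at this)
  refine ⟨fun z => m z / (I * Real.pi), by fun_prop, fun z hz => ?_⟩
  have hpi : (Real.pi : ℂ) ≠ 0 := by exact_mod_cast Real.pi_ne_zero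
  have e1 : (Real.pi : ℂ) * (m z / (I * Real.pi)) * I = m z := by field_simp
  rw [Complex.cos, neg_mul, e1, exp_neg, hme z hz]
  have hne : h z + I * exp (l z / 2) ≠ 0 := by
    intro e; have := hprod z hz; rw [e] at this; simp at this
  rw [inv_eq_of_mul_eq_one_right (hprod z hz)]
  ring

lemma exp_abs_im_le (x : ℂ) : Real.exp |x.im| ≤ 2 * ‖Complex.cos x‖ + 1 := by
  have n1 : ‖exp (x * I)‖ = Real.exp (-x.im) := by simp [norm_exp]
  have n2 : ‖exp (-x * I)‖ = Real.exp (x.im) := by simp [norm_exp]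
  have hc : 2 * ‖Complex.cos x‖ = ‖exp (x * I) + exp (-x * I)‖ := by
    rw [Complex.cos, norm_div]; simp; ring
  rw [hc]
  rcases le_total 0 x.im with h | h
  · rw [abs_of_nonneg h]
    have := norm_sub_le (exp (x * I) + exp (-x * I)) (exp (x * I))
    rw [add_sub_cancel_left, n1, n2] at this
    have : Real.exp (-x.im) ≤ 1 := Real.exp_le_one_iff.2 (by linarith)
    linarith
  · rw [abs_of_nonpos h]
    have := norm_sub_le (exp (x * I) + exp (-x * I)) (exp (-x * I))
    rw [add_sub_cancel_right, n1, n2] at this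
    have : Real.exp (x.im) ≤ 1 := Real.exp_le_one_iff.2 (by linarith)
    linarith

lemma norm_cos_le_exp (x : ℂ) : ‖Complex.cos x‖ ≤ Real.exp |x.im| := by
  have n1 : ‖exp (x * I)‖ = Real.exp (-x.im) := by simp [norm_exp]
  have n2 : ‖exp (-x * I)‖ = Real.exp (x.im) := by simp [norm_exp]
  have hc : 2 * ‖Complex.cos x‖ = ‖exp (x * I) + exp (-x * I)‖ := by
    rw [Complex.cos, norm_div]; simp; ring
  have := norm_add_le (exp (x * I)) (exp (-x * I))
  have a1 : Real.exp (-x.im) ≤ Real.exp |x.im| := Real.exp_le_exp.2 (neg_le_abs _)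
  have a2 : Real.exp (x.im) ≤ Real.exp |x.im| := Real.exp_le_exp.2 (le_abs_self _)
  linarith

lemma exists_int_cos_near (q : ℂ) :
    ∃ p : ℂ, ‖p - q‖ < 2 ∧ ∃ n : ℤ, Complex.cos (Real.pi * p) = n := by
  -- first the imaginary part
  have key : ∀ y : ℝ, 0 ≤ y → ∃ y' : ℝ, y ≤ y' ∧ y' ≤ y + 1 ∧ ∃ n : ℤ, Real.cosh (Real.pi * y') = n := by
    intro y hy
    have hpi := Real.pi_gt_three
    have hgrow : Real.cosh (Real.pi * y) + 1 ≤ Real.cosh (Real.pi * (y + 1)) := by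
      have : Real.pi * (y + 1) = Real.pi * y + Real.pi := by ring
      rw [this, Real.cosh_add]
      have h1 : 2 ≤ Real.cosh Real.pi := by
        rw [Real.cosh_eq]
        have := Real.add_one_le_exp Real.pi
        have := Real.exp_pos (-Real.pi)
        linarith
      have h2 : 1 ≤ Real.cosh (Real.pi * y) := Real.one_le_cosh _
      have h3 : 0 ≤ Real.sinh (Real.pi * y) := Real.sinh_nonneg_iff.2 (by positivity)
      have h4 : 0 ≤ Real.sinh Real.pi := Real.sinh_nonneg_iff.2 (by positivity)
      nlinarith [mul_nonneg h3 h4]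
    have hcont : ContinuousOn (fun y : ℝ => Real.cosh (Real.pi * y)) (Icc y (y + 1)) := by fun_prop
    have := intermediate_value_Icc (by linarith : y ≤ y + 1) hcont
    obtain ⟨y', hy', e⟩ := this (show ((⌈Real.cosh (Real.pi * y)⌉ : ℤ) : ℝ) ∈ _ from
      ⟨Int.le_ceil _, by have := Int.ceil_lt_add_one (Real.cosh (Real.pi * y)); linarith⟩)
    exact ⟨y', hy'.1, hy'.2, _, e⟩
  have key2 : ∀ y : ℝ, ∃ y' : ℝ, |y' - y| ≤ 1 ∧ ∃ n : ℤ, Real.cosh (Real.pi * y') = n := by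
    intro y
    rcases le_total 0 y with h | h
    · obtain ⟨y', a, b, c⟩ := key y h
      exact ⟨y', abs_le.2 ⟨by linarith, by linarith⟩, c⟩
    · obtain ⟨y', a, b, n, c⟩ := key (-y) (by linarith)
      exact ⟨-y', abs_le.2 ⟨by linarith, by linarith⟩, n, by rw [← c, mul_neg, Real.cosh_neg]⟩
  obtain ⟨y', hy', n, hn⟩ := key2 q.im
  set m : ℤ := round q.re
  obtain ⟨k, h3⟩ : ∃ k : ℤ, Complex.cos (m * Real.pi) = k := by
    have h4 := Complex.sin_sq_add_cos_sq (m * Real.pi)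
    rw [Complex.sin_int_mul_pi] at h4
    have : (Complex.cos (m * Real.pi) - 1) * (Complex.cos (m * Real.pi) + 1) = 0 := by
      linear_combination h4
    rcases mul_eq_zero.1 this with e | e
    · exact ⟨1, by push_cast; linear_combination e⟩
    · exact ⟨-1, by push_cast; linear_combination e⟩
  refine ⟨(m : ℂ) + y' * I, ?_, k * n, ?_⟩
  · have h1 : |(m : ℝ) - q.re| ≤ 1 / 2 := by rw [abs_sub_comm]; exact abs_sub_round _
    have h2 := Complex.norm_le_abs_re_add_abs_im ((m : ℂ) + y' * I - q)
    simp at h2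
    linarith
  · have : (Real.pi : ℂ) * ((m : ℂ) + y' * I) = ((Real.pi * y' : ℝ) : ℂ) * I + m * Real.pi := by
      push_cast; ring
    rw [this, Complex.cos_add, Complex.sin_int_mul_pi, h3, Complex.cos_mul_I,
      ← Complex.ofReal_cosh, hn]
    push_cast
    ring

lemma surj_half {h : ℂ → ℂ} {a : ℂ} {ε : ℝ} (hε : 0 ≤ ε)
    (H : ∀ x ∈ closedBall a ε, ∀ y ∈ closedBall a ε, ‖h x - h y - (x - y)‖ ≤ 1 / 2 * ‖x - y‖) :
    SurjOn h (closedBall a ε) (closedBall (h a) (ε / 2)) := by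
  have A : ApproximatesLinearOn h ((ContinuousLinearEquiv.refl ℂ ℂ : ℂ ≃L[ℂ] ℂ) : ℂ →L[ℂ] ℂ)
      (closedBall a ε) (1 / 2) := by
    intro x hx y hy
    simpa using H x hx y hy
  have := A.surjOn_closedBall_of_nonlinearRightInverse
    (ContinuousLinearEquiv.toNonlinearRightInverse (ContinuousLinearEquiv.refl ℂ ℂ)) hε subset_rfl
  have e : ((((ContinuousLinearEquiv.refl ℂ ℂ).toNonlinearRightInverse.nnnorm : ℝ)⁻¹
      - ((1/2 : NNReal) : ℝ)) * ε) = ε / 2 := by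
    have : ((ContinuousLinearEquiv.refl ℂ ℂ).toNonlinearRightInverse.nnnorm : ℝ) = 1 := by
      simp [ContinuousLinearEquiv.toNonlinearRightInverse]
    rw [this]; push_cast; ring
  rw [e] at this
  exact this

lemma approx_of_deriv {h : ℂ → ℂ} {a : ℂ} {ε : ℝ}
    (hd : ∀ z ∈ closedBall a ε, DifferentiableAt ℂ h z)
    (hb : ∀ z ∈ closedBall a ε, ‖deriv h z - 1‖ ≤ 1 / 2) :
    ∀ x ∈ closedBall a ε, ∀ y ∈ closedBall a ε, ‖h x - h y - (x - y)‖ ≤ 1 / 2 * ‖x - y‖ := by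
  intro x hx y hy
  have := (convex_closedBall a ε).norm_image_sub_le_of_norm_hasDerivWithin_le
    (f := fun z => h z - z) (f' := fun z => deriv h z - 1) (C := 1/2)
    (fun z hz => ((hd z hz).hasDerivAt.sub (hasDerivAt_id z)).hasDerivWithinAt)
    hb hy hx
  have e : h x - h y - (x - y) = (h x - x) - (h y - y) := by ring
  rw [e]
  exact this

/-- Bloch type estimate: a function whose image contains no disc of radius `2`. -/
lemma bloch_deriv {h : ℂ → ℂ} {c : ℂ} {R : ℝ} (hR : 0 < R) (hh : DifferentiableOn ℂ h (ball c R))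
    (hno : ∀ q : ℂ, ∃ p : ℂ, ‖p - q‖ < 2 ∧ ∀ z ∈ ball c R, h z ≠ p) :
    ‖deriv h c‖ ≤ 96 / R := by
  have hsub : closedBall c (R/2) ⊆ ball c R := closedBall_subset_ball (by linarith)
  have hd' : DifferentiableOn ℂ (deriv h) (ball c R) := hh.deriv isOpen_ball
  obtain ⟨a, ha, hmax⟩ := (isCompact_closedBall c (R/2)).exists_isMaxOn ⟨c, by simp; linarith⟩
    (f := fun z => ‖deriv h z‖ * (R/2 - ‖z - c‖))
    (by
      have := hd'.continuousOn.mono hsub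
      fun_prop)
  have hmc : ‖deriv h c‖ * (R/2) ≤ ‖deriv h a‖ * (R/2 - ‖a - c‖) := by
    have := hmax (show c ∈ closedBall c (R/2) by simp; linarith)
    simpa using this
  by_contra hcon
  push Not at hcon
  have hm : 48 < ‖deriv h c‖ * (R/2) := by
    rw [div_lt_iff₀ hR] at hcon; linarith
  set d := R/2 - ‖a - c‖ with hdd
  set b := deriv h a with hb
  have hd0 : 0 < d := by
    by_contra hc'
    push Not at hc'
    have : ‖b‖ * d ≤ 0 := mul_nonpos_of_nonneg_of_nonpos (norm_nonneg _) hc'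
    linarith
  have hb0 : 0 < ‖b‖ := by
    by_contra hc'
    have : ‖b‖ = 0 := le_antisymm (not_lt.1 hc') (norm_nonneg _)
    rw [this] at hmc; linarith
  have hbne : b ≠ 0 := norm_pos_iff.1 hb0
  have hball : ∀ z, ‖z - a‖ ≤ d / 2 → z ∈ closedBall c (R/2) ∧ ‖deriv h z‖ ≤ 2 * ‖b‖ := by
    intro z hz
    have t : ‖z - c‖ ≤ ‖z - a‖ + ‖a - c‖ := by
      have := norm_add_le (z - a) (a - c); simpa using this
    have hz' : z ∈ closedBall c (R/2) := by
      rw [mem_closedBall, dist_eq_norm]; linarith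
    refine ⟨hz', ?_⟩
    have h1 : ‖deriv h z‖ * (R/2 - ‖z - c‖) ≤ ‖b‖ * d := hmax hz'
    have h2 : d / 2 ≤ R/2 - ‖z - c‖ := by linarith
    have h3 : ‖deriv h z‖ * (d/2) ≤ ‖b‖ * d := le_trans (by gcongr) h1
    nlinarith
  have hschw : ∀ z ∈ closedBall a (d/12), ‖deriv h z - b‖ ≤ ‖b‖ / 2 := by
    intro z hz
    have := Complex.dist_le_div_mul_dist_of_mapsTo_ball (f := deriv h) (c := a) (R₁ := d/2)
      (R₂ := 3 * ‖b‖) (z := z) (hd'.mono (fun w hw => hsub (hball w (by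
        rw [mem_ball, dist_eq_norm] at hw; exact hw.le)).1)) (by
        intro w hw
        rw [mem_ball, dist_eq_norm] at hw
        rw [mem_closedBall, dist_eq_norm]
        have := (hball w hw.le).2
        have := norm_sub_le (deriv h w) (deriv h a)
        linarith) (by
        rw [mem_closedBall] at hz; rw [mem_ball]; linarith)
    rw [dist_eq_norm] at this
    rw [mem_closedBall] at hz
    calc _ ≤ _ := this
      _ ≤ 3 * ‖b‖ / (d/2) * (d/12) := by gcongr
      _ = ‖b‖/2 := by field_simp; norm_num
  have hin : ∀ z ∈ closedBall a (d/12), z ∈ ball c R := fun z hz => hsub (hball z (by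
    rw [mem_closedBall, dist_eq_norm] at hz; linarith)).1
  have hdiff : ∀ z ∈ closedBall a (d/12), DifferentiableAt ℂ h z := fun z hz =>
    (hh z (hin z hz)).differentiableAt (isOpen_ball.mem_nhds (hin z hz))
  have S := surj_half (h := fun z => h z / b) (a := a) (ε := d/12) (by linarith)
    (approx_of_deriv (fun z hz => (hdiff z hz).div_const b) (by
      intro z hz
      rw [deriv_div_const]
      have : deriv h z / b - 1 = (deriv h z - b) / b := by field_simp
      rw [this, norm_div, div_le_iff₀ hb0]
      have := hschw z hz
      linarith))
  obtain ⟨p, hp, hpn⟩ := hno (h a)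
  obtain ⟨z, hz, e⟩ := S (show p / b ∈ _ by
    rw [mem_closedBall, dist_eq_norm]
    have : p / b - h a / b = (p - h a) / b := by ring
    rw [this, norm_div, div_le_iff₀ hb0]
    nlinarith)
  refine hpn z (hin z hz) ?_
  simp only at e
  field_simp at e
  exact e

/-- Schottky theorem, with a polynomial dependence. -/
lemma schottky : ∃ (C : ℝ) (A : ℕ), 0 < C ∧ 1 ≤ A ∧ ∀ H : ℂ → ℂ,
    DifferentiableOn ℂ H (ball 0 20) → (∀ z ∈ ball (0:ℂ) 20, H z ≠ 0) →
    (∀ z ∈ ball (0:ℂ) 20, H z ≠ 1) → ∀ v₁ ∈ ball (0:ℂ) 10, ∀ v₂ ∈ ball (0:ℂ) 10,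
    ‖H v₁‖ ≤ C * (1 + ‖H v₂‖) ^ A := by
  obtain ⟨B, hB⟩ := exists_nat_ge (Real.exp (Real.pi * 192))
  have hB1 : (1:ℝ) ≤ B := le_trans (Real.one_le_exp (by positivity)) hB
  refine ⟨(Real.exp (3 * Real.pi) * 16) ^ B + 1, 2 * B, by positivity, by
    have : 1 ≤ B := by exact_mod_cast hB1
    omega, ?_⟩
  intro H hH h0 h1 v₁ hv₁ v₂ hv₂
  have hsub : ball (0:ℂ) 10 ⊆ ball (0:ℂ) 20 := ball_subset_ball (by norm_num)
  obtain ⟨F', hF', hFe'⟩ := exists_cos_on_ball (h := fun z => 2 * H z - 1) (c := 0) (R := 20)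
    (by fun_prop) (by
      intro z hz e; exact h1 z hz (by linear_combination e / 2)) (by
      intro z hz e; exact h0 z hz (by linear_combination e / 2))
  -- normalise
  obtain ⟨F, hF, hFe, hFre⟩ : ∃ F : ℂ → ℂ, DifferentiableOn ℂ F (ball 0 20) ∧
      (∀ z ∈ ball (0:ℂ) 20, Complex.cos (Real.pi * F z) = 2 * H z - 1) ∧ |(F v₂).re| ≤ 1 := by
    refine ⟨fun z => F' z - 2 * (round ((F' v₂).re / 2) : ℤ), by fun_prop, ?_, ?_⟩
    · intro z hz
      rw [← hFe' z hz, mul_sub]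
      have : (Real.pi : ℂ) * (2 * (round ((F' v₂).re / 2) : ℤ)) =
        (round ((F' v₂).re / 2) : ℤ) * (2 * Real.pi) := by ring
      rw [this, Complex.cos_sub_int_mul_two_pi]
    · have := abs_sub_round ((F' v₂).re / 2)
      simp
      rw [abs_le] at this ⊢
      constructor <;> linarith
  have hint : ∀ z ∈ ball (0:ℂ) 20, ∀ n : ℤ, F z ≠ n := by
    intro z hz n e
    have := hFe z hz
    rw [e, mul_comm, ] at this
    have h3 : Complex.sin (n * Real.pi) = 0 := Complex.sin_int_mul_pi n
    have h4 := Complex.sin_sq_add_cos_sq (n * Real.pi)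
    rw [h3, this] at h4
    have : H z * (H z - 1) = 0 := by linear_combination h4 / 4
    rcases mul_eq_zero.1 this with e | e
    · exact h0 z hz e
    · exact h1 z hz (by linear_combination e)
  obtain ⟨g, hg, hge⟩ := exists_cos_on_ball hF (fun z hz => by simpa using hint z hz 1)
    (fun z hz => by simpa using hint z hz (-1))
  have hgd : ∀ z ∈ ball (0:ℂ) 10, ‖deriv g z‖ ≤ 9.6 := by
    intro z hz
    have hs : ball z 10 ⊆ ball 0 20 := by
      intro w hw
      rw [mem_ball] at *
      linarith [dist_triangle w z 0]
    have := bloch_deriv (by norm_num) (hg.mono hs) (by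
      intro q
      obtain ⟨p, hp, n, hn⟩ := exists_int_cos_near q
      refine ⟨p, hp, fun w hw e => ?_⟩
      refine hint w (hs hw) n ?_
      rw [← hge w (hs hw), e, hn])
    norm_num at this ⊢
    exact this
  have hgdist : ‖g v₁ - g v₂‖ ≤ 192 := by
    have := (convex_ball (0:ℂ) 10).norm_image_sub_le_of_norm_deriv_le (f := g) (C := 9.6)
      (fun z hz => (hg z (hsub hz)).differentiableAt (isOpen_ball.mem_nhds (hsub hz))) hgd hv₂ hv₁
    have h2 : ‖v₁ - v₂‖ ≤ 20 := by
      have := norm_sub_le v₁ v₂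
      simp at hv₁ hv₂
      linarith
    linarith
  have i1 : |(g v₁).im| ≤ |(g v₂).im| + 192 := by
    have := (Complex.abs_im_le_norm (g v₁ - g v₂)).trans hgdist
    rw [Complex.sub_im] at this
    have := abs_sub_abs_le_abs_sub (g v₁).im (g v₂).im
    linarith
  have im_pi : ∀ x : ℂ, |((Real.pi : ℂ) * x).im| = Real.pi * |x.im| := by
    intro x; simp [abs_mul, abs_of_pos Real.pi_pos]
  have F1 : ‖F v₁‖ ≤ B * (2 * ‖F v₂‖ + 1) := by
    rw [← hge v₁ (hsub hv₁)]
    refine (norm_cos_le_exp _).trans ?_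
    rw [im_pi]
    have e2 := exp_abs_im_le (Real.pi * g v₂)
    rw [im_pi, hge v₂ (hsub hv₂)] at e2
    calc Real.exp (Real.pi * |(g v₁).im|) ≤ Real.exp (Real.pi * 192 + Real.pi * |(g v₂).im|) := by
          apply Real.exp_le_exp.2
          nlinarith [Real.pi_pos]
      _ = Real.exp (Real.pi * 192) * Real.exp (Real.pi * |(g v₂).im|) := Real.exp_add _ _
      _ ≤ _ := by gcongr
  have F2 : ‖F v₂‖ ≤ 1 + |(F v₂).im| := by
    have := Complex.norm_le_abs_re_add_abs_im (F v₂)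
    linarith
  have e2 := exp_abs_im_le (Real.pi * F v₂)
  rw [im_pi, hFe v₂ (hsub hv₂)] at e2
  have e3 : Real.exp (Real.pi * |(F v₂).im|) ≤ 4 * (1 + ‖H v₂‖) := by
    have := norm_sub_le (2 * H v₂) 1
    simp at this
    linarith
  have e4 : ‖2 * H v₁ - 1‖ ≤ (Real.exp (3 * Real.pi) * 16) ^ B * (1 + ‖H v₂‖) ^ (2 * B) := by
    rw [← hFe v₁ (hsub hv₁)]
    refine (norm_cos_le_exp _).trans ?_
    rw [im_pi]
    calc Real.exp (Real.pi * |(F v₁).im|) ≤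
          Real.exp (B * (3 * Real.pi + 2 * (Real.pi * |(F v₂).im|))) := by
          apply Real.exp_le_exp.2
          have : |(F v₁).im| ≤ B * (3 + 2 * |(F v₂).im|) := by
            refine (Complex.abs_im_le_norm _).trans (F1.trans ?_)
            exact mul_le_mul_of_nonneg_left (by linarith) (by positivity)
          calc _ ≤ Real.pi * (B * (3 + 2 * |(F v₂).im|)) := by gcongr
            _ = _ := by ring
      _ = (Real.exp (3 * Real.pi) * Real.exp (Real.pi * |(F v₂).im|) ^ 2) ^ B := by
          rw [Real.exp_nat_mul, Real.exp_add]
          congr 2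
          rw [← Real.exp_nat_mul]; norm_num
      _ ≤ (Real.exp (3 * Real.pi) * (4 * (1 + ‖H v₂‖)) ^ 2) ^ B := by gcongr
      _ = _ := by rw [pow_mul, ← mul_pow]; ring
  have e5 : ‖H v₁‖ ≤ ‖2 * H v₁ - 1‖ + 1 := by
    have := norm_add_le (2 * H v₁ - 1) 1
    simp at this
    linarith [norm_nonneg (H v₁)]
  have e6 : 1 ≤ (1 + ‖H v₂‖) ^ (2 * B) := one_le_pow₀ (by linarith [norm_nonneg (H v₂)])
  nlinarith

end

section
open Complex Metric Set Filter Topology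

lemma exists_inverse_branch {L : ℂ → ℂ} {K : ℝ} (hL : DifferentiableOn ℂ L (ball 0 K))
    (hb : ∀ u ∈ ball (0:ℂ) K, ‖L u - u‖ ≤ 1) :
    ∃ Λ : ℂ → ℂ, DifferentiableOn ℂ Λ (ball 0 (K - 6)) ∧ ∀ v ∈ ball (0:ℂ) (K - 6),
      Λ v ∈ ball (0:ℂ) K ∧ L (Λ v) = v ∧ ‖Λ v - v‖ ≤ 1 := by
  have hin : ∀ u : ℂ, ‖u‖ ≤ K - 3 → u ∈ ball (0:ℂ) K := fun u hu => by
    rw [mem_ball_zero_iff]; linarith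
  have hda : ∀ u : ℂ, ‖u‖ ≤ K - 3 → DifferentiableAt ℂ L u := fun u hu =>
    (hL u (hin u hu)).differentiableAt (isOpen_ball.mem_nhds (hin u hu))
  have hder : ∀ u : ℂ, ‖u‖ ≤ K - 3 → ‖deriv L u - 1‖ ≤ 1 / 2 := by
    intro u hu
    have hsub : closedBall u 2 ⊆ ball (0:ℂ) K := by
      intro w hw
      rw [mem_closedBall, dist_eq_norm] at hw
      rw [mem_ball_zero_iff]
      have := norm_add_le (w - u) u
      rw [sub_add_cancel] at this
      linarith
    have h1 : DiffContOnCl ℂ (fun z => L z - z) (ball u 2) := by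
      apply DifferentiableOn.diffContOnCl
      rw [closure_ball u (by norm_num)]
      exact (hL.mono hsub).sub differentiableOn_id
    have h2 := norm_deriv_le_of_forall_mem_sphere_norm_le (C := 1) (by norm_num : (0:ℝ) < 2) h1
      (fun z hz => hb z (hsub (sphere_subset_closedBall hz)))
    have h3 : deriv (fun z => L z - z) u = deriv L u - 1 :=
      ((hda u hu).hasDerivAt.sub (hasDerivAt_id u)).deriv
    rwa [h3] at h2
  have hex : ∀ v ∈ ball (0:ℂ) (K - 6), ∃ u, ‖u‖ ≤ K - 4 ∧ L u = v ∧ ‖u - v‖ ≤ 1 := by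
    intro v hv
    rw [mem_ball_zero_iff] at hv
    have hsub : ∀ w ∈ closedBall v 2, ‖w‖ ≤ K - 4 := by
      intro w hw
      rw [mem_closedBall, dist_eq_norm] at hw
      have := norm_add_le (w - v) v
      rw [sub_add_cancel] at this
      linarith
    have S := surj_half (h := L) (a := v) (ε := 2) (by norm_num)
      (approx_of_deriv (fun z hz => hda z (by linarith [hsub z hz]))
        (fun z hz => hder z (by linarith [hsub z hz])))
    obtain ⟨u, hu, e⟩ := S (show v ∈ _ by
      rw [mem_closedBall, dist_comm, dist_eq_norm]
      have := hb v (hin v (by linarith))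
      linarith)
    refine ⟨u, hsub u hu, e, ?_⟩
    have := hb u (hin u (by linarith [hsub u hu]))
    rwa [e, norm_sub_rev] at this
  choose! Λ hΛ using hex
  have hanti : ∀ x y : ℂ, ‖x‖ ≤ K - 4 → ‖y‖ ≤ K - 4 → ‖x - y‖ ≤ 2 * ‖L x - L y‖ := by
    intro x y hx hy
    have := approx_of_deriv (h := L) (a := 0) (ε := K - 4)
      (fun z hz => hda z (by rw [mem_closedBall_zero_iff] at hz; linarith))
      (fun z hz => hder z (by rw [mem_closedBall_zero_iff] at hz; linarith)) x
      (by rwa [mem_closedBall_zero_iff]) y (by rwa [mem_closedBall_zero_iff])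
    have h2 := norm_sub_le (L x - L y) (L x - L y - (x - y))
    rw [sub_sub_cancel] at h2
    linarith
  refine ⟨Λ, ?_, fun v hv => ⟨hin _ (by linarith [(hΛ v hv).1]), (hΛ v hv).2⟩⟩
  intro v hv
  have hnb : ball (0:ℂ) (K - 6) ∈ 𝓝 v := isOpen_ball.mem_nhds hv
  have hcont : ContinuousAt Λ v := by
    refine continuousAt_of_locally_lipschitz (r := K - 6 - ‖v‖) (K := 2) (by
      rw [mem_ball_zero_iff] at hv; linarith) ?_
    intro w hw
    have hw' : w ∈ ball (0:ℂ) (K - 6) := by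
      rw [dist_eq_norm] at hw
      rw [mem_ball_zero_iff]
      have := norm_add_le (w - v) v
      rw [sub_add_cancel] at this
      linarith
    have := hanti (Λ w) (Λ v) (hΛ w hw').1 (hΛ v hv).1
    rw [(hΛ w hw').2.1, (hΛ v hv).2.1] at this
    rwa [dist_eq_norm, dist_eq_norm]
  have hu : ‖Λ v‖ ≤ K - 3 := by linarith [(hΛ v hv).1]
  have hne : deriv L (Λ v) ≠ 0 := by
    intro e
    have := hder _ hu
    rw [e] at this
    norm_num at this
  exact (HasDerivAt.of_local_left_inverse hcont (hda _ hu).hasDerivAt hne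
    (by filter_upwards [hnb] with w hw using (hΛ w hw).2.1)).differentiableAt.differentiableWithinAt

/-- transcendental entire -/
def TransEntire (f : ℂ → ℂ) : Prop :=
  Differentiable ℂ f ∧ ¬ ∃ p : Polynomial ℂ, ∀ z : ℂ, f z = p.eval z

lemma exists_max_point {f : ℂ → ℂ} (hf : Differentiable ℂ f) {r : ℝ} (hr : 0 < r) :
    ∃ m : ℂ, ‖m‖ = r ∧ ∀ w : ℂ, ‖w‖ ≤ r → ‖f w‖ ≤ ‖f m‖ := by
  obtain ⟨m, hm, hmax⟩ := exists_mem_frontier_isMaxOn_norm (f := f) (U := ball (0:ℂ) r)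
    isBounded_ball ⟨0, by simpa⟩ hf.diffContOnCl
  rw [frontier_ball _ hr.ne', mem_sphere_zero_iff_norm] at hm
  refine ⟨m, hm, fun w hw => hmax ?_⟩
  rw [closure_ball _ hr.ne']
  simpa using hw

lemma TransEntire.growth {f : ℂ → ℂ} (hf : TransEntire f) (N : ℕ) (C : ℝ) :
    ∀ᶠ r : ℝ in atTop, ∀ m : ℂ, ‖m‖ = r → (∀ w : ℂ, ‖w‖ ≤ r → ‖f w‖ ≤ ‖f m‖) →
      C * r ^ N ≤ ‖f m‖ := by
  by_contra hcon
  apply hf.2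
  have hfreq : ∃ᶠ r : ℝ in atTop, ∀ w : ℂ, ‖w‖ ≤ r → ‖f w‖ ≤ C * r ^ N := by
    rw [Filter.not_eventually] at hcon
    refine hcon.mono fun r hr => ?_
    push Not at hr
    obtain ⟨m, hm, hmax, hlt⟩ := hr
    exact fun w hw => (hmax w hw).trans hlt.le
  have hz : ∀ n, N + 1 ≤ n → iteratedDeriv n f 0 = 0 := by
    intro n hn
    by_contra hne
    have hpos : 0 < ‖iteratedDeriv n f 0‖ := norm_pos_iff.2 hne
    obtain ⟨r, hr, hr1, hr2⟩ := (hfreq.and_eventually ((eventually_ge_atTop 1).and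
      (eventually_gt_atTop (n.factorial * C / ‖iteratedDeriv n f 0‖)))).exists
    have hr0 : 0 < r := by linarith
    have h1 := norm_iteratedDeriv_le_of_forall_mem_sphere_norm_le (f := f) (c := 0) n hr0
      hf.1.diffContOnCl (C := C * r ^ N) (fun z hz => hr z (by simpa using hz.le))
    have hC : 0 ≤ C * r ^ N := (norm_nonneg _).trans (hr 0 (by simpa using hr0.le))
    have h2 : (n.factorial : ℝ) * (C * r ^ N) / r ^ n ≤ n.factorial * C / r := by
      rw [div_le_div_iff₀ (by positivity) hr0]
      have : r ^ (N + 1) ≤ r ^ n := pow_le_pow_right₀ hr1 hn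
      have hC' : 0 ≤ C := nonneg_of_mul_nonneg_left hC (by positivity)
      calc _ = n.factorial * C * r ^ (N + 1) := by ring
        _ ≤ _ := by gcongr
    rw [div_lt_iff₀ hpos] at hr2
    have h3 := h1.trans h2
    rw [le_div_iff₀ hr0] at h3
    linarith
  refine ⟨∑ n ∈ Finset.range (N + 1), Polynomial.C ((n.factorial : ℂ)⁻¹ * iteratedDeriv n f 0)
    * Polynomial.X ^ n, fun z => ?_⟩
  have h1 := taylorSeries_eq_of_entire' (c := 0) (z := z) hf.1
  rw [← h1, tsum_eq_sum (s := Finset.range (N + 1))]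
  · simp [Polynomial.eval_finsetSum]
  · intro n hn
    rw [Finset.mem_range, not_lt] at hn
    simp [hz n hn]

lemma three_circles {f : ℂ → ℂ} (hf : Differentiable ℂ f) {A B y θ : ℝ} (hy : 1 < y)
    (hA : ∀ w, ‖w‖ = 1 → ‖f w‖ ≤ A) (hB : ∀ w, ‖w‖ = y → ‖f w‖ ≤ B)
    (hθ0 : 0 ≤ θ) (hθ1 : θ ≤ 1) {w : ℂ} (hw : ‖w‖ = y ^ θ) :
    ‖f w‖ ≤ A ^ (1 - θ) * B ^ θ := by
  have hy0 : 0 < y := by linarith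
  have hlog : 0 < Real.log y := Real.log_pos hy
  have hw0 : w ≠ 0 := by
    rw [← norm_pos_iff, hw]; exact Real.rpow_pos_of_pos hy0 _
  have hre : (Complex.log w).re = θ * Real.log y := by
    rw [Complex.log_re, hw, Real.log_rpow hy0]
  have hdF : Differentiable ℂ (fun ζ => f (exp ζ)) := hf.comp differentiable_exp
  obtain ⟨m, -, hm⟩ := exists_max_point hf hy0
  have := HadamardThreeLines.norm_le_interp_of_mem_verticalClosedStrip' (f := fun ζ => f (exp ζ))
    (z := Complex.log w) (a := A) (b := B) hlog (by
      simp only [HadamardThreeLines.verticalClosedStrip, mem_preimage, hre, mem_Icc]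
      exact ⟨by positivity, by nlinarith⟩) hdF.diffContOnCl (by
      refine ⟨‖f m‖, ?_⟩
      rintro _ ⟨ζ, hζ, rfl⟩
      refine hm _ ?_
      rw [norm_exp, ← Real.le_log_iff_exp_le hy0]
      exact hζ.2) (by
      intro ζ hζ
      refine hA _ ?_
      rw [norm_exp, show ζ.re = 0 from hζ, Real.exp_zero]) (by
      intro ζ hζ
      refine hB _ ?_
      rw [norm_exp, show ζ.re = Real.log y from hζ, Real.exp_log hy0])
  simp only [exp_log hw0, hre, sub_zero] at this
  rwa [mul_div_cancel_right₀ _ hlog.ne'] at this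

lemma TransEntire.doubling {f : ℂ → ℂ} (hf : TransEntire f) (N : ℕ) :
    ∀ᶠ ρ : ℝ in atTop, ∃ w' : ℂ, ‖w'‖ = ρ / 2 ∧ 1 ≤ ‖f w'‖ ∧
      ∀ w : ℂ, ‖w‖ ≤ ρ / 4 → 2 ^ N * ‖f w‖ < ‖f w'‖ := by
  obtain ⟨m1, hm1, hmax1⟩ := exists_max_point hf.1 one_pos
  set A := ‖f m1‖ + 1 with hAdef
  have hA1 : 1 ≤ A := by have := norm_nonneg (f m1); linarith
  have hg := (tendsto_id.atTop_div_const (by norm_num : (0:ℝ) < 2)).eventually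
    (hf.growth (N + 1) A)
  filter_upwards [hg, eventually_gt_atTop (4:ℝ)] with ρ hρ hρ4
  simp only [id] at hρ
  obtain ⟨m, hm, hmax⟩ := exists_max_point hf.1 (by linarith : 0 < ρ / 2)
  have hB := hρ m hm hmax
  set y := ρ / 2 with hy
  have hy2 : 2 < y := by linarith
  have hB1 : 1 ≤ ‖f m‖ := by
    have : 1 ≤ y ^ (N + 1) := one_le_pow₀ (by linarith)
    nlinarith
  refine ⟨m, hm, hB1, ?_⟩
  intro w hw
  obtain ⟨n, hn, hnmax⟩ := exists_max_point hf.1 (by linarith : 0 < ρ / 4)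
  have hly : 0 < Real.log y := Real.log_pos (by linarith)
  set t := Real.log 2 / Real.log y with ht
  have ht0 : 0 < t := div_pos (Real.log_pos (by norm_num)) hly
  have ht1 : t ≤ 1 := by
    rw [ht, div_le_one hly]; exact Real.log_le_log (by norm_num) (by linarith)
  have hyt : y ^ t = 2 := by
    rw [Real.rpow_def_of_pos (by linarith), ht, mul_div_cancel₀ _ hly.ne', Real.exp_log (by norm_num)]
  have h3 := three_circles hf.1 (A := A) (B := ‖f m‖) (y := y) (θ := 1 - t) (w := n) (by linarith)
    (fun w hw => by have := hmax1 w hw.le; linarith) (fun w hw => hmax w hw.le)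
    (by linarith) (by linarith) (by
      rw [hn, Real.rpow_sub (by linarith), hyt, Real.rpow_one, hy]; ring)
  rw [sub_sub_cancel, Real.rpow_sub (by linarith), Real.rpow_one] at h3
  have h4 : A ^ t * 2 ^ (N + 1) ≤ ‖f m‖ ^ t := by
    have : (A * y ^ (N + 1)) ^ t ≤ ‖f m‖ ^ t :=
      Real.rpow_le_rpow (by positivity) hB ht0.le
    rw [Real.mul_rpow (by positivity) (by positivity), ← Real.rpow_natCast, ← Real.rpow_mul
      (by positivity), mul_comm _ t, Real.rpow_mul (by positivity), hyt, Real.rpow_natCast] at this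
    exact this
  have hBt : 0 < ‖f m‖ ^ t := Real.rpow_pos_of_pos (by linarith) _
  have h5 : ‖f n‖ * 2 ^ (N + 1) ≤ ‖f m‖ := by
    calc ‖f n‖ * 2 ^ (N + 1) ≤ A ^ t * (‖f m‖ / ‖f m‖ ^ t) * 2 ^ (N + 1) := by gcongr
      _ = (A ^ t * 2 ^ (N + 1)) * (‖f m‖ / ‖f m‖ ^ t) := by ring
      _ ≤ ‖f m‖ ^ t * (‖f m‖ / ‖f m‖ ^ t) := by gcongr
      _ = ‖f m‖ := by field_simp
  have h6 := hnmax w hw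
  have h7 : ‖f w‖ * 2 ^ (N + 1) ≤ ‖f m‖ := le_trans (by gcongr) h5
  rw [pow_succ] at h7
  by_cases h0 : ‖f w‖ = 0
  · rw [h0]; simp; intro e; rw [e] at hB1; simp at hB1; linarith
  · have : 0 < 2 ^ N * ‖f w‖ := by positivity
    nlinarith

lemma TransEntire.power {f : ℂ → ℂ} (hf : TransEntire f) (k : ℕ) (hk : 1 ≤ k) :
    ∀ᶠ x : ℝ in atTop, ∃ w' : ℂ, ‖w'‖ = x ^ (2 * k) ∧
      ∀ w : ℂ, ‖w‖ ≤ x → ‖f w‖ ^ k < ‖f w'‖ := by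
  obtain ⟨m1, hm1, hmax1⟩ := exists_max_point hf.1 one_pos
  set A := ‖f m1‖ + 1 with hAdef
  have hA1 : 1 ≤ A := by have := norm_nonneg (f m1); linarith
  have hg := (tendsto_pow_atTop (α := ℝ) (n := 2 * k) (by omega)).eventually
    (hf.growth 0 (A ^ (2 * k) + 1))
  filter_upwards [hg, eventually_gt_atTop (1:ℝ)] with x hx hx1
  have hy1 : 1 < x ^ (2 * k) := one_lt_pow₀ hx1 (by omega)
  obtain ⟨m, hm, hmax⟩ := exists_max_point hf.1 (by linarith : 0 < x ^ (2 * k))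
  have hB := hx m hm hmax
  rw [pow_zero, mul_one] at hB
  refine ⟨m, hm, fun w hw => ?_⟩
  obtain ⟨n, hn, hnmax⟩ := exists_max_point hf.1 (by linarith : 0 < x)
  have hk0 : (0:ℝ) < k := by exact_mod_cast hk
  set θ : ℝ := ((2 * k : ℕ) : ℝ)⁻¹ with hθ
  have hθ0 : 0 < θ := by rw [hθ]; push_cast; positivity
  have hθ1 : θ ≤ 1 := by
    rw [hθ]; apply inv_le_one_of_one_le₀; exact_mod_cast (by omega : 1 ≤ 2 * k)
  have h3 := three_circles hf.1 (A := A) (B := ‖f m‖) (y := x ^ (2 * k)) (θ := θ) (w := n) hy1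
    (fun w hw => by have := hmax1 w hw.le; linarith) (fun w hw => hmax w hw.le) hθ0.le hθ1 (by
      rw [hn, hθ, Real.pow_rpow_inv_natCast (by linarith) (by omega)])
  set b := ‖f m‖ ^ θ with hb
  have hbk : b ^ (2 * k) = ‖f m‖ := by
    rw [hb, hθ, Real.rpow_inv_natCast_pow (norm_nonneg _) (by omega)]
  have hb0 : 0 < b := Real.rpow_pos_of_pos (by have : 0 < A ^ (2*k) := by positivity
                                               linarith) _
  have hAb : A < b := by
    refine lt_of_pow_lt_pow_left₀ (2 * k) hb0.le ?_
    rw [hbk]; linarith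
  have hAt : A ^ (1 - θ) ≤ A := by
    have := Real.rpow_le_rpow_of_exponent_le hA1 (by linarith : 1 - θ ≤ 1)
    rwa [Real.rpow_one] at this
  have h4 : ‖f w‖ ≤ A * b := (hnmax w hw).trans (h3.trans (by gcongr))
  calc ‖f w‖ ^ k ≤ (A * b) ^ k := by gcongr
    _ < (b * b) ^ k := by
      apply pow_lt_pow_left₀ _ (by positivity) (by omega)
      gcongr
    _ = ‖f m‖ := by rw [← hbk, ← pow_two, ← pow_mul]

end

section
open Complex Metric Set Filter Topology

lemma exp_neg_le_one_sub {u : ℝ} (hu : |u| ≤ 1/100) : Real.exp (-u - 2*u^2) ≤ 1 - u := by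
  obtain ⟨h1, h2⟩ := abs_le.mp hu
  have h3 : |(-u - 2*u^2)| ≤ 1 := by
    rw [abs_le]; constructor <;> nlinarith
  have h4 := (abs_le.mp (Real.abs_exp_sub_one_sub_id_le h3)).2
  have : (-u - 2*u^2)^2 ≤ 2*u^2 := by
    have : (-u - 2*u^2)^2 = u^2 * (1+2*u)^2 := by ring
    rw [this]
    have : (1+2*u)^2 ≤ 2 := by nlinarith
    nlinarith [sq_nonneg u]
  linarith

lemma norm_le_of_parts {s : ℝ} (w : ℂ) (hs : 0 < s) (h : s/2 ≤ w.re) :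
    ‖w‖ ≤ w.re + w.im^2/s := by
  have h0 : 0 ≤ w.im^2/s := by positivity
  refine abs_le_of_sq_le_sq' ?_ (by linarith) |>.2
  rw [Complex.sq_norm, Complex.normSq_apply]
  have : w.im^2 = (w.im^2/s)*s := by field_simp
  nlinarith

lemma wv_growth {K s d l : ℝ} (hK : 1 ≤ K) (hs : 0 < s) (hd : 0 < d) (hds : d ≤ 3*s)
    (hl : 300*K^2 ≤ l) {ζ : ℂ} (hζ : ‖ζ‖ < 2*K) :
    ∃ u : ℝ, u < 1 ∧ ‖(s:ℂ) + (d/l:ℝ) * ζ‖ ≤ s + d * u ∧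
      Real.exp (-ζ.re - 1/10) ≤ Real.exp ((-u-2*u^2) * l) ∧ |u| ≤ 1/100 := by
  have hl0 : 0 < l := by nlinarith
  have hre := abs_le.mp ((Complex.abs_re_le_norm ζ).trans hζ.le)
  have him := abs_le.mp ((Complex.abs_im_le_norm ζ).trans hζ.le)
  set e := d/l with he
  have he0 : 0 < e := by positivity
  have hel : e * l = d := by rw [he]; field_simp
  have hes : e * (100*K^2) ≤ s := by nlinarith
  have hesK : e * (100*K) ≤ s := by nlinarith [mul_nonneg he0.le (by nlinarith : 0 ≤ K^2-K)]
  set w : ℂ := (s:ℂ) + (e:ℝ) * ζ with hw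
  have hwre : w.re = s + e * ζ.re := by simp [hw]
  have hwim : w.im = e * ζ.im := by simp [hw]
  have h1 : s/2 ≤ w.re := by
    rw [hwre]; nlinarith
  have h2 := norm_le_of_parts w hs h1
  have h3 : w.im^2/s ≤ e/25 := by
    rw [hwim, div_le_iff₀ hs]
    have : ζ.im^2 ≤ 4*K^2 := by nlinarith
    nlinarith [mul_le_mul_of_nonneg_left this (by positivity : 0 ≤ e^2)]
  set τ := ζ.re + 1/25 with hτ
  have hτK : |τ| ≤ 3*K := by rw [abs_le]; constructor <;> linarith
  have hτ2 : τ^2 ≤ 9*K^2 := by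
    have := abs_le.mp hτK; nlinarith
  have hu : |τ/l| ≤ 1/100 := by
    rw [abs_div, abs_of_pos hl0, div_le_iff₀ hl0]; nlinarith
  refine ⟨τ/l, by linarith [(abs_le.mp hu).2], ?_, ?_, hu⟩
  · have : d * (τ/l) = e * τ := by rw [he]; ring
    rw [this]; rw [hwre] at h2; rw [hτ]; linarith
  · apply Real.exp_le_exp.mpr
    have : (-(τ/l) - 2*(τ/l)^2)*l = -τ - 2*τ^2/l := by field_simp
    rw [this]
    have : 2*τ^2/l ≤ 6/100 := by rw [div_le_iff₀ hl0]; nlinarith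
    rw [hτ] at *; linarith

lemma wv (K : ℝ) (hK : 1 ≤ K) : ∃ l : ℕ, 1 ≤ l ∧ ∀ g, TransEntire g → ∀ᶠ ρ : ℝ in atTop,
    ∃ z0 κ : ℂ, ρ/4 ≤ ‖z0‖ ∧ ‖z0‖ ≤ ρ ∧ (∀ z, ‖z‖ ≤ ‖z0‖ → ‖g z‖ ≤ ‖g z0‖) ∧
      ‖κ‖ * (100*K) ≤ ‖z0‖ ∧ 1 ≤ l * ‖κ‖ * ‖g z0‖ ∧
      ∃ L : ℂ → ℂ, DifferentiableOn ℂ L (ball 0 K) ∧ ∀ ζ ∈ ball (0:ℂ) K,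
        ‖L ζ - ζ‖ ≤ 1 ∧ g (z0 + κ * ζ) = g z0 * exp (L ζ) := by
  obtain ⟨l, hl⟩ := exists_nat_ge (300*K^2)
  have hl1 : (1:ℝ) ≤ l := by nlinarith
  have hl0 : (0:ℝ) < l := by linarith
  have hl1' : 1 ≤ l := by exact_mod_cast hl1
  refine ⟨l, hl1', fun g hg => ?_⟩
  obtain ⟨r0, hr0⟩ := eventually_atTop.mp (hg.growth 0 1)
  filter_upwards [hg.doubling l, eventually_ge_atTop 2, eventually_ge_atTop (4*r0)] with ρ hdb hρ2 hρr
  obtain ⟨w', hw', hw1, hw2⟩ := hdb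
  have hgc : Continuous g := hg.1.continuous
  obtain ⟨z0, hz0, hmax⟩ := (isCompact_closedBall (0:ℂ) ρ).exists_isMaxOn
    ⟨0, by simp; linarith⟩ (f := fun z => ‖g z‖*(ρ-‖z‖)^l) (by fun_prop)
  have hmax' : ∀ z, ‖z‖ ≤ ρ → ‖g z‖*(ρ-‖z‖)^l ≤ ‖g z0‖*(ρ-‖z0‖)^l := fun z hz =>
    hmax (by simpa using hz)
  have hz0ρ : ‖z0‖ ≤ ρ := by simpa using hz0
  have hv : ‖g w'‖ * (ρ/2)^l ≤ ‖g z0‖*(ρ-‖z0‖)^l := by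
    have := hmax' w' (by rw [hw']; linarith)
    rw [hw'] at this
    convert this using 3; ring
  have hpos : 1 ≤ (ρ/2)^l := one_le_pow₀ (by linarith)
  have hv1 : 1 ≤ ‖g z0‖*(ρ-‖z0‖)^l := by nlinarith
  have hs4 : ρ/4 < ‖z0‖ := by
    by_contra hcon
    push Not at hcon
    have h1 := hw2 z0 hcon
    have h2 : (ρ-‖z0‖)^l ≤ ρ^l := pow_le_pow_left₀ (by linarith) (by linarith [norm_nonneg z0]) _
    have h3 : ρ^l = 2^l*(ρ/2)^l := by rw [← mul_pow]; congr 1; ring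
    rw [h3] at h2
    have h4 : ‖g z0‖*(ρ-‖z0‖)^l ≤ ‖g z0‖*(2^l*(ρ/2)^l) :=
      mul_le_mul_of_nonneg_left h2 (norm_nonneg _)
    have h5 : 2^l*‖g z0‖*(ρ/2)^l < ‖g w'‖*(ρ/2)^l :=
      mul_lt_mul_of_pos_right h1 (by linarith)
    nlinarith
  set s := ‖z0‖ with hs
  have hs0 : 0 < s := by linarith
  set d := ρ - s with hd
  have hd0 : 0 < d := by
    rcases (sub_nonneg.mpr hz0ρ).eq_or_lt with h | h
    · have hdz : d = 0 := by rw [hd]; exact h.symm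
      rw [hdz, zero_pow (by omega)] at hv1; simp at hv1; linarith
    · exact h
  have hds : d ≤ 3*s := by linarith
  have hmono : ∀ z, ‖z‖ ≤ s → ‖g z‖ ≤ ‖g z0‖ := by
    intro z hz
    have h1 := hmax' z (by linarith)
    have h2 : d^l ≤ (ρ-‖z‖)^l := pow_le_pow_left₀ hd0.le (by linarith) _
    have h3 : ‖g z‖*d^l ≤ ‖g z0‖*d^l :=
      (mul_le_mul_of_nonneg_left h2 (norm_nonneg _)).trans h1
    exact le_of_mul_le_mul_right h3 (by positivity)
  have hg1 : 1 ≤ ‖g z0‖ := by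
    have := hr0 s (by linarith) z0 rfl hmono
    simpa using this
  have hg0 : g z0 ≠ 0 := by
    intro h; rw [h] at hg1; simp at hg1; linarith
  set κ : ℂ := (z0/s) * ((d/l:ℝ):ℂ) with hκ
  have hκn : ‖κ‖ = d/l := by
    rw [hκ, norm_mul, norm_div, Complex.norm_real, Complex.norm_real, Real.norm_of_nonneg hs0.le,
      Real.norm_of_nonneg (by positivity), ← hs, div_self hs0.ne', one_mul]
  refine ⟨z0, κ, hs4.le, hz0ρ, hmono, ?_, ?_, ?_⟩
  · rw [hκn, div_mul_eq_mul_div, div_le_iff₀ hl0]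
    have : 300*K ≤ l := by nlinarith
    nlinarith
  · rw [hκn, mul_div_cancel₀ _ hl0.ne']
    rcases le_or_gt 1 d with h | h
    · nlinarith
    · have : d^l ≤ d := pow_le_of_le_one hd0.le h.le (by omega)
      nlinarith
  · have hbd : ∀ ζ : ℂ, ‖ζ‖ < 2*K → ‖g (z0+κ*ζ)‖ ≤ ‖g z0‖ * Real.exp (ζ.re+1/10) := by
      intro ζ hζ
      obtain ⟨u, hu1, hu2, hu3, hu4⟩ := wv_growth hK hs0 hd0 hds hl hζ
      have hz : ‖z0+κ*ζ‖ = ‖(s:ℂ) + (d/l:ℝ) * ζ‖ := by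
        have : z0+κ*ζ = (z0/s) * ((s:ℂ) + (d/l:ℝ) * ζ) := by
          rw [hκ, mul_add, div_mul_cancel₀ _ (by exact_mod_cast hs0.ne')]; ring
        rw [this, norm_mul, norm_div, Complex.norm_real, Real.norm_of_nonneg hs0.le, ← hs,
          div_self hs0.ne', one_mul]
      rw [← hz] at hu2
      have h1 : d*(1-u) ≤ ρ-‖z0+κ*ζ‖ := by linarith
      have h1' : 0 < d*(1-u) := mul_pos hd0 (by linarith)
      have h2 := hmax' (z0+κ*ζ) (by linarith)
      have h3 : (d*(1-u))^l ≤ (ρ-‖z0+κ*ζ‖)^l := pow_le_pow_left₀ h1'.le h1 _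
      have h4 : ‖g (z0+κ*ζ)‖*(1-u)^l*d^l ≤ ‖g z0‖*d^l := by
        have := (mul_le_mul_of_nonneg_left h3 (norm_nonneg (g (z0+κ*ζ)))).trans h2
        rw [mul_pow] at this; linarith
      have h5 := le_of_mul_le_mul_right h4 (by positivity)
      have h6 : Real.exp (-ζ.re - 1/10) ≤ (1-u)^l := by
        refine hu3.trans ?_
        rw [mul_comm, Real.exp_nat_mul]
        exact pow_le_pow_left₀ (Real.exp_pos _).le (exp_neg_le_one_sub hu4) _
      have h7 : ‖g (z0+κ*ζ)‖ * Real.exp (-ζ.re - 1/10) ≤ ‖g z0‖ :=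
        (mul_le_mul_of_nonneg_left h6 (norm_nonneg _)).trans h5
      have h8 := mul_le_mul_of_nonneg_right h7 (Real.exp_pos (ζ.re+1/10)).le
      rw [mul_assoc, ← Real.exp_add] at h8
      simpa using h8
    set F : ℂ → ℂ := fun ζ => g (z0+κ*ζ) * exp (-ζ) / g z0 - 1 with hF
    have hFd : Differentiable ℂ F := by
      have := hg.1
      have h2 : Differentiable ℂ fun ζ => g (z0+κ*ζ) := this.comp (by fun_prop)
      exact ((h2.mul (by fun_prop)).div_const _).sub_const _
    have hFb : ∀ ζ ∈ ball (0:ℂ) K, ‖F ζ‖ ≤ 1/2 := by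
      intro ζ hζ
      have hζ' : ‖ζ‖ < K := by simpa using hζ
      have := Complex.borelCaratheodory_zero (M := 1/4) (R := 2*K) (z := ζ) (f := F) (by norm_num)
        hFd.differentiableOn ?_ (by linarith) (by simp; linarith) (by simp [hF, hg0])
      · refine this.trans ?_
        rw [div_le_iff₀ (by linarith)]
        linarith
      · intro x hx
        have hx' : ‖x‖ < 2*K := by simpa using hx
        have h1 := hbd x hx'
        have h2 : ‖g (z0+κ*x) * exp (-x) / g z0‖ ≤ 5/4 := by
          rw [norm_div, norm_mul, Complex.norm_exp, div_le_iff₀ (by linarith), neg_re]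
          have h3 := mul_le_mul_of_nonneg_right h1 (Real.exp_pos (-x.re)).le
          rw [mul_assoc ‖g z0‖, ← Real.exp_add] at h3
          have h4 : x.re+1/10 + -x.re = 1/10 := by ring
          rw [h4] at h3
          have h5 := (abs_le.mp (Real.abs_exp_sub_one_sub_id_le (x := 1/10) (by rw [abs_le]; norm_num))).2
          nlinarith
        have h3 := Complex.re_le_norm (g (z0+κ*x) * exp (-x) / g z0)
        simp only [hF, mem_ofPred_eq, sub_re, one_re]
        linarith
    have hFs : ∀ ζ ∈ ball (0:ℂ) K, 1 + F ζ ∈ slitPlane := fun ζ hζ =>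
      Complex.mem_slitPlane_of_norm_lt_one (by linarith [hFb ζ hζ])
    refine ⟨fun ζ => ζ + log (1 + F ζ), ?_, fun ζ hζ => ⟨?_, ?_⟩⟩
    · refine differentiableOn_id.add (DifferentiableOn.clog ?_ hFs)
      exact (hFd.const_add _).differentiableOn
    · have := Complex.norm_log_one_add_half_le_self (hFb ζ hζ)
      simp only [add_sub_cancel_left]
      linarith [hFb ζ hζ]
    · have h1 := Complex.slitPlane_ne_zero (hFs ζ hζ)
      rw [Complex.exp_add, Complex.exp_log h1]
      simp only [hF]
      rw [add_sub_cancel, mul_div_assoc', mul_div_assoc', mul_comm, mul_comm (exp ζ), mul_assoc (g _), ← Complex.exp_add]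
      simp [hg0]

end

section
open Complex Metric Set Filter Topology

lemma schottky_real {C r M X Y l : ℝ} {A : ℕ} (hr4 : 4 ≤ r) (hrl : l ≤ r) (hl : 0 ≤ l)
    (hrC : C ≤ r) (hY : 0 ≤ Y) (hM : r^(4*A+3) ≤ M)
    (hM2 : (M - 2*r)/r ≤ C * (1 + (Y+2*r)*l*r/4)^A)
    (hX2 : (X - 2*r)/r ≤ C * (1 + (Y+2*r)*l*r/4)^A) : X ≤ Y^(2*A+2) := by
  have hr0 : 0 < r := by linarith
  rcases lt_or_ge Y (r^2) with h | h
  · exfalso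
    have h1 : 1 + (Y+2*r)*l*r/4 ≤ r^4 := by
      have h2 : Y + 2*r ≤ 2*r^2 := by nlinarith
      have h3 : (Y+2*r)*l ≤ 2*r^2*r := mul_le_mul h2 hrl hl (by positivity)
      have h4 : (Y+2*r)*l*r ≤ 2*r^2*r*r := mul_le_mul_of_nonneg_right h3 hr0.le
      have h5 : 1 ≤ r^3 := one_le_pow₀ (by linarith)
      nlinarith
    have h2 : C * (1 + (Y+2*r)*l*r/4)^A ≤ r * (r^4)^A := by
      have : (1 + (Y+2*r)*l*r/4)^A ≤ (r^4)^A := pow_le_pow_left₀ (by positivity) h1 _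
      exact mul_le_mul hrC this (by positivity) hr0.le
    have h3 := hM2.trans h2
    rw [div_le_iff₀ hr0, ← pow_mul] at h3
    have h4 : 1 ≤ r^(4*A) := one_le_pow₀ (by linarith)
    have h5 : r^(4*A+3) = r*(r^2*r^(4*A)) := by ring
    have h6 : r^2 ≤ r^2*r^(4*A) := by nlinarith [sq_nonneg r]
    rw [h5] at hM
    nlinarith
  · have hY1 : 4*r ≤ Y := by nlinarith
    have h1 : 1 + (Y+2*r)*l*r/4 ≤ Y^2 := by
      have h3 : (Y+2*r)*l ≤ 2*Y*r := mul_le_mul (by linarith) hrl hl (by positivity)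
      have h4 : (Y+2*r)*l*r ≤ 2*Y*r*r := mul_le_mul_of_nonneg_right h3 hr0.le
      nlinarith
    have h2 : C * (1 + (Y+2*r)*l*r/4)^A ≤ r * (Y^2)^A := by
      have : (1 + (Y+2*r)*l*r/4)^A ≤ (Y^2)^A := pow_le_pow_left₀ (by positivity) h1 _
      exact mul_le_mul hrC this (by positivity) hr0.le
    have h3 := hX2.trans h2
    rw [div_le_iff₀ hr0, ← pow_mul] at h3
    have h4 : 1 ≤ Y^(2*A) := one_le_pow₀ (by linarith)
    have h5 : Y^(2*A+2) = Y*(Y*Y^(2*A)) := by ring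
    have h6 : Y ≤ Y*Y^(2*A) := by nlinarith
    have h7 : r*r*Y^(2*A) ≤ Y*Y^(2*A) := mul_le_mul_of_nonneg_right (by nlinarith) (by positivity)
    rw [h5]
    nlinarith

lemma exists_exp_of_norm_eq {w0 w : ℂ} (h0 : w0 ≠ 0) (h : ‖w‖ = ‖w0‖) :
    ∃ v ∈ ball (0:ℂ) 10, w = w0 * exp v := by
  have hw : w ≠ 0 := by
    rw [← norm_ne_zero_iff, h]; exact norm_ne_zero_iff.mpr h0
  refine ⟨log (w/w0), ?_, ?_⟩
  · rw [mem_ball_zero_iff]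
    refine (Complex.norm_le_abs_re_add_abs_im _).trans_lt ?_
    rw [Complex.log_re, norm_div, h, div_self (norm_ne_zero_iff.mpr h0), Complex.log_im]
    have := Complex.abs_arg_le_pi (w/w0)
    simp only [Real.log_one, abs_zero, zero_add]
    linarith [Real.pi_lt_four]
  · rw [Complex.exp_log (div_ne_zero hw h0)]
    field_simp

lemma lemmaA : ∃ k : ℕ, 1 ≤ k ∧ ∀ f g, TransEntire f → TransEntire g →
    {z : ℂ | f (g z) = z}.Finite → ∀ᶠ ρ : ℝ in atTop, ∃ z0 : ℂ, ρ/4 ≤ ‖z0‖ ∧ ‖z0‖ ≤ ρ ∧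
      (∀ z, ‖z‖ ≤ ‖z0‖ → ‖g z‖ ≤ ‖g z0‖) ∧
      ∀ w w1, ‖w‖ = ‖g z0‖ → ‖w1‖ = ‖g z0‖ → ‖f w1‖ ≤ ‖f w‖^k := by
  obtain ⟨C, A, hC, hA, hS⟩ := schottky
  obtain ⟨l, hl1, hwv⟩ := wv 40 (by norm_num)
  refine ⟨2*A+2, by omega, fun f g hf hg hfin => ?_⟩
  obtain ⟨R0, hR0⟩ := hfin.isBounded.exists_norm_le
  obtain ⟨ρg, hρg⟩ := eventually_atTop.mp (hg.growth 1 1)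
  obtain ⟨ρf, hρf⟩ := eventually_atTop.mp (hf.growth (4*A+3) 1)
  filter_upwards [hwv g hg, eventually_ge_atTop (4*ρg), eventually_ge_atTop (4*ρf),
    eventually_ge_atTop (8*R0+16), eventually_ge_atTop 16, eventually_ge_atTop (4*(l:ℝ)),
    eventually_ge_atTop (4*C)] with ρ hρ h1 h2 h3 h4 h5 h6
  obtain ⟨z0, κ, hs1, hs2, hmono, hκ1, hκ2, L, hL, hLb⟩ := hρ
  refine ⟨z0, hs1, hs2, hmono, ?_⟩
  set s := ‖z0‖ with hs
  set w0 := g z0 with hw0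
  set r := ‖w0‖ with hr
  have hsr : s ≤ r := by
    have := hρg s (by linarith) z0 rfl hmono
    simpa using this
  have hr4 : 4 ≤ r := by linarith
  have hr0 : 0 < r := by linarith
  have hw00 : w0 ≠ 0 := norm_ne_zero_iff.mp hr0.ne'
  have hl0 : (0:ℝ) < l := by exact_mod_cast hl1
  have hκ0 : 0 < ‖κ‖ := by
    rcases (norm_nonneg κ).eq_or_lt with h | h
    · rw [← h] at hκ2; simp at hκ2; linarith
    · exact h
  obtain ⟨Λ, hΛd, hΛ⟩ := exists_inverse_branch hL (fun u hu => (hLb u hu).1)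
  norm_num at hΛd hΛ
  set ψ : ℂ → ℂ := fun v => z0 + κ * Λ v with hψ
  have hgψ : ∀ v ∈ ball (0:ℂ) 34, g (ψ v) = w0 * exp v := by
    intro v hv
    obtain ⟨a, b, c⟩ := hΛ v (by simpa using hv)
    have := (hLb (Λ v) (by simpa using a)).2
    rw [b] at this
    exact this
  have hψb : ∀ v ∈ ball (0:ℂ) 34, s/2 ≤ ‖ψ v‖ ∧ ‖ψ v‖ ≤ 2*s := by
    intro v hv
    obtain ⟨a, b, c⟩ := hΛ v (by simpa using hv)
    have h7 : ‖κ * Λ v‖ ≤ s/2 := by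
      rw [norm_mul]
      have := mul_le_mul_of_nonneg_left a.le hκ0.le
      linarith
    constructor
    · have := norm_sub_le (z0 + κ * Λ v) (κ * Λ v)
      rw [add_sub_cancel_right] at this
      simp only [hψ]; linarith
    · have := norm_add_le z0 (κ * Λ v)
      simp only [hψ]; linarith
  have hne : ∀ v ∈ ball (0:ℂ) 34, f (w0 * exp v) ≠ ψ v := by
    intro v hv h
    rw [← hgψ v hv] at h
    have := hR0 (ψ v) h
    have := (hψb v hv).1
    linarith
  have hmem : ∀ v ∈ ball (0:ℂ) 20, v ∈ ball (0:ℂ) 34 ∧ v + 2*Real.pi*I ∈ ball (0:ℂ) 34 := by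
    intro v hv
    rw [mem_ball_zero_iff] at hv ⊢
    rw [mem_ball_zero_iff]
    refine ⟨by linarith, ?_⟩
    refine (norm_add_le _ _).trans_lt ?_
    have : ‖(2*Real.pi*I : ℂ)‖ = 2*Real.pi := by simp [abs_of_pos Real.pi_pos]
    rw [this]
    linarith [Real.pi_lt_four]
  set D : ℂ → ℂ := fun v => κ * (Λ (v + 2*Real.pi*I) - Λ v) with hD
  have hDb : ∀ v ∈ ball (0:ℂ) 20, 4*‖κ‖ ≤ ‖D v‖ ∧ ‖D v‖ ≤ 9*‖κ‖ := by
    intro v hv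
    obtain ⟨m1, m2⟩ := hmem v hv
    have a := (hΛ v (by simpa using m1)).2.2
    have b := (hΛ _ (by simpa using m2)).2.2
    have e : ‖(2*Real.pi*I : ℂ)‖ = 2*Real.pi := by simp [abs_of_pos Real.pi_pos]
    have c : ‖(Λ (v + 2*Real.pi*I) - Λ v) - 2*Real.pi*I‖ ≤ 2 := by
      have : (Λ (v + 2*Real.pi*I) - Λ v) - 2*Real.pi*I =
        (Λ (v + 2*Real.pi*I) - (v + 2*Real.pi*I)) - (Λ v - v) := by ring
      rw [this]
      refine (norm_sub_le _ _).trans (by linarith)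
    have c1 := norm_sub_norm_le (Λ (v + 2*Real.pi*I) - Λ v) (2*Real.pi*I)
    have c2 := norm_sub_norm_le (2*Real.pi*I) (Λ (v + 2*Real.pi*I) - Λ v)
    rw [norm_sub_rev (2*Real.pi*I : ℂ)] at c2
    rw [e] at c1 c2
    have p1 := Real.pi_gt_three
    have p2 := Real.pi_lt_d2
    have n1 : 4 ≤ ‖Λ (v + 2*Real.pi*I) - Λ v‖ := by linarith
    have n2 : ‖Λ (v + 2*Real.pi*I) - Λ v‖ ≤ 9 := by norm_num at p2; linarith
    simp only [hD, norm_mul]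
    constructor <;> nlinarith
  have hD0 : ∀ v ∈ ball (0:ℂ) 20, D v ≠ 0 := by
    intro v hv
    rw [← norm_pos_iff]
    linarith [(hDb v hv).1]
  have hHd : DifferentiableOn ℂ (fun v => (f (w0 * exp v) - ψ v) / D v) (ball 0 20) := by
    have hsub : MapsTo (fun v : ℂ => v) (ball (0:ℂ) 20) (ball (0:ℂ) 34) := fun v hv => (hmem v hv).1
    have hsub2 : MapsTo (fun v : ℂ => v + 2*Real.pi*I) (ball (0:ℂ) 20) (ball (0:ℂ) 34) :=
      fun v hv => (hmem v hv).2
    have e1 : DifferentiableOn ℂ Λ (ball 0 20) := hΛd.mono hsub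
    have e2 : DifferentiableOn ℂ (fun v => Λ (v + 2*Real.pi*I)) (ball 0 20) :=
      hΛd.comp (by fun_prop) hsub2
    have e3 : Differentiable ℂ (fun v => f (w0 * exp v)) := hf.1.comp (by fun_prop)
    refine DifferentiableOn.div (e3.differentiableOn.sub ?_) ?_ hD0
    · exact (e1.const_mul κ).const_add z0
    · exact (e2.sub e1).const_mul κ
  have key := hS _ hHd (by
      intro v hv
      exact div_ne_zero (sub_ne_zero.mpr (hne v (hmem v hv).1)) (hD0 v hv)) (by
      intro v hv h
      rw [div_eq_one_iff_eq (hD0 v hv)] at h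
      apply hne _ (hmem v hv).2
      rw [Complex.exp_add, Complex.exp_two_pi_mul_I, mul_one]
      have : ψ (v + 2*Real.pi*I) = ψ v + D v := by simp only [hψ, hD]; ring
      rw [this, ← h]; ring)
  have h20 : ∀ v ∈ ball (0:ℂ) 10, v ∈ ball (0:ℂ) 20 := fun v hv => by
    rw [mem_ball_zero_iff] at *; linarith
  have main : ∀ w w1, ‖w‖ = r → ‖w1‖ = r →
      (‖f w1‖ - 2*r)/r ≤ C * (1 + (‖f w‖+2*r)*l*r/4)^A := by
    intro w w1 hw hw1
    obtain ⟨v, hv, rfl⟩ := exists_exp_of_norm_eq hw00 hw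
    obtain ⟨v1, hv1, rfl⟩ := exists_exp_of_norm_eq hw00 hw1
    have k1 := key v1 hv1 v hv
    have k2 : (‖f (w0 * exp v1)‖ - 2*r)/r ≤ ‖(f (w0 * exp v1) - ψ v1) / D v1‖ := by
      rw [norm_div]
      have hd := hDb v1 (h20 v1 hv1)
      have hp := hψb v1 (hmem v1 (h20 v1 hv1)).1
      have n := norm_sub_norm_le (f (w0 * exp v1)) (ψ v1)
      have hn := norm_nonneg (f (w0 * exp v1) - ψ v1)
      have hd0 : 0 < ‖D v1‖ := by linarith
      rw [div_le_div_iff₀ hr0 hd0]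
      have hdr : ‖D v1‖ ≤ r := by linarith
      calc _ ≤ ‖f (w0 * exp v1) - ψ v1‖ * ‖D v1‖ :=
            mul_le_mul_of_nonneg_right (by linarith) hd0.le
        _ ≤ _ := mul_le_mul_of_nonneg_left hdr hn
    have k3 : ‖(f (w0 * exp v) - ψ v) / D v‖ ≤ (‖f (w0 * exp v)‖+2*r)*l*r/4 := by
      rw [norm_div]
      have hd := hDb v (h20 v hv)
      have hp := hψb v (hmem v (h20 v hv)).1
      have n := norm_sub_le (f (w0 * exp v)) (ψ v)
      have hd0 : 0 < ‖D v‖ := by linarith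
      rw [div_le_iff₀ hd0]
      have hd1 : 1 ≤ l*r/4*‖D v‖ := by
        have := mul_le_mul_of_nonneg_left hd.1 (by positivity : 0 ≤ l*r/4)
        nlinarith
      have hf0 := norm_nonneg (f (w0 * exp v))
      calc _ ≤ (‖f (w0 * exp v)‖+2*r) * 1 := by linarith
        _ ≤ (‖f (w0 * exp v)‖+2*r) * (l*r/4*‖D v‖) :=
            mul_le_mul_of_nonneg_left hd1 (by positivity)
        _ = _ := by ring
    refine k2.trans (k1.trans ?_)
    gcongr
  intro w w1 hw hw1
  obtain ⟨m, hm, hmmax⟩ := exists_max_point hf.1 hr0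
  have hM := hρf r (by linarith) m hm hmmax
  rw [one_mul] at hM
  exact schottky_real hr4 (by linarith) hl0.le (by linarith) (norm_nonneg _) hM
    (main w m hw hm) (main w w1 hw hw1)

end

section
open Complex Metric Set Filter Topology

lemma factor_zeros (S : Finset ℂ) : ∀ q : ℂ → ℂ, Differentiable ℂ q → (∃ z, q z ≠ 0) →
    (∀ z, q z = 0 → z ∈ S) → ∃ (P E : ℂ → ℂ) (N : ℕ) (B : ℝ), Differentiable ℂ E ∧
      (∀ z, E z ≠ 0) ∧ (∀ z, q z = P z * E z) ∧ 0 ≤ B ∧ ∀ z, ‖P z‖ ≤ B * (1+‖z‖)^N := by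
  induction S using Finset.induction_on with
  | empty =>
    intro q hq _ h
    exact ⟨fun _ => 1, q, 0, 1, hq, fun z hz => by simpa using h z hz, by simp, by simp, by simp⟩
  | insert a S ha ih =>
    intro q hq hne h
    have hqa : AnalyticAt ℂ q a := hq.analyticAt a
    have hnz : ¬ ∀ᶠ z in 𝓝 a, q z = 0 := by
      intro hz
      obtain ⟨z, hz'⟩ := hne
      have hA : AnalyticOnNhd ℂ q univ := fun x _ => hq.analyticAt x
      exact hz' (hA.eqOn_zero_of_preconnected_of_eventuallyEq_zero isPreconnected_univ
        (mem_univ a) hz (mem_univ z))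
    obtain ⟨n, h0, h0a, h0ne, h0eq⟩ := hqa.exists_eventuallyEq_pow_smul_nonzero_iff.mpr hnz
    set Q : ℂ → ℂ := fun z => if z = a then h0 a else q z / (z-a)^n with hQ
    have hQa : Q =ᶠ[𝓝 a] h0 := by
      filter_upwards [h0eq] with z hz
      by_cases hza : z = a
      · simp [hQ, hza]
      · have : (z-a)^n ≠ 0 := pow_ne_zero _ (sub_ne_zero.mpr hza)
        simp only [hQ, hza, if_false, hz, smul_eq_mul]
        field_simp
    have hQd : Differentiable ℂ Q := by
      intro z
      by_cases hza : z = a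
      · rw [hza]
        exact h0a.differentiableAt.congr_of_eventuallyEq hQa
      · have h1 : DifferentiableAt ℂ (fun z => q z / (z-a)^n) z :=
          (hq z).div (by fun_prop) (pow_ne_zero _ (sub_ne_zero.mpr hza))
        refine h1.congr_of_eventuallyEq ?_
        filter_upwards [isOpen_ne.mem_nhds hza] with y hy
        have hy' : y ≠ a := hy
        simp [hQ, hy']
    have hqQ : ∀ z, q z = (z-a)^n * Q z := by
      intro z
      by_cases hza : z = a
      · have := h0eq.self_of_nhds
        simp only [hQ, hza, if_true]
        simpa using this
      · have : (z-a)^n ≠ 0 := pow_ne_zero _ (sub_ne_zero.mpr hza)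
        simp only [hQ, hza, if_false]
        field_simp
    obtain ⟨P, E, N, B, hE, hE0, hPE, hB, hP⟩ := ih Q hQd ⟨a, by simp [hQ, h0ne]⟩ (by
      intro z hz
      have h1 := h z (by rw [hqQ, hz, mul_zero])
      rcases Finset.mem_insert.mp h1 with h2 | h2
      · rw [h2] at hz; simp [hQ, h0ne] at hz
      · exact h2)
    refine ⟨fun z => (z-a)^n * P z, E, n+N, (1+‖a‖)^n*B, hE, hE0, fun z => ?_, by positivity,
      fun z => ?_⟩
    · rw [hqQ, hPE, mul_assoc]
    · rw [norm_mul, norm_pow]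
      have h1 : ‖z-a‖ ≤ (1+‖a‖)*(1+‖z‖) := by
        have := norm_sub_le z a
        nlinarith [norm_nonneg z, norm_nonneg a, mul_nonneg (norm_nonneg z) (norm_nonneg a)]
      calc _ ≤ ((1+‖a‖)*(1+‖z‖))^n * (B*(1+‖z‖)^N) := by
            gcongr
            exact hP z
        _ = _ := by rw [mul_pow, pow_add]; ring

lemma fix_swap {f g : ℂ → ℂ} (h : {z : ℂ | f (g z) = z}.Finite) :
    {w : ℂ | g (f w) = w}.Finite := by
  refine Set.Finite.of_finite_image (f := f) (h.subset ?_) ?_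
  · rintro _ ⟨w, hw, rfl⟩
    have hw' : g (f w) = w := hw
    show f (g (f w)) = f w
    rw [hw']
  · intro w hw w' hw' e
    have h1 : g (f w) = w := hw
    have h2 : g (f w') = w' := hw'
    rw [← h1, ← h2, e]

lemma main_thm {f g : ℂ → ℂ} (hf : TransEntire f) (hg : TransEntire g) :
    {z : ℂ | f (g z) = z}.Infinite := by
  intro hfin
  have hfin2 := fix_swap hfin
  obtain ⟨k, hk, hA⟩ := lemmaA
  have hfc : Continuous f := hf.1.continuous
  have hqd : Differentiable ℂ (fun w => g (f w) - w) := (hg.1.comp hf.1).sub differentiable_id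
  obtain ⟨P, E, N, B, hE, hE0, hPE, hB, hP⟩ := factor_zeros hfin2.toFinset
    (fun w => g (f w) - w) hqd (by
      by_contra hcon
      push Not at hcon
      refine Set.infinite_univ (α := ℂ) (hfin2.subset fun w _ => ?_)
      exact sub_eq_zero.mp (hcon w)) (by
      intro z hz
      rw [Set.Finite.mem_toFinset]
      exact sub_eq_zero.mp hz)
  have hEpos : 0 < ‖E 0‖ := norm_pos_iff.mpr (hE0 0)
  obtain ⟨x1, hx1⟩ := eventually_atTop.mp (hf.growth (4*k) (4^(4*k)))
  obtain ⟨t1, ht1⟩ := eventually_atTop.mp (hg.growth (k*(N+2)) 1)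
  obtain ⟨y1, hy1⟩ := eventually_atTop.mp (hg.growth 1 1)
  -- conditions on x
  have hx : ∀ᶠ x : ℝ in atTop, (∃ w', ‖w'‖ = x^(2*k) ∧ ∀ w, ‖w‖ ≤ x → ‖f w‖^k < ‖f w'‖) ∧
      (∃ z0 : ℂ, x/4 ≤ ‖z0‖ ∧ ‖z0‖ ≤ x ∧
      (∀ z, ‖z‖ ≤ ‖z0‖ → ‖f z‖ ≤ ‖f z0‖) ∧
      ∀ w w1, ‖w‖ = ‖f z0‖ → ‖w1‖ = ‖f z0‖ → ‖g w1‖ ≤ ‖g w‖^k) ∧ 4*x1 ≤ x :=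
    (hf.power k hk).and ((hA g f hg hf hfin2).and (eventually_ge_atTop _))
  have hkR : (0:ℝ) < 1/(2*k:ℕ) := by positivity
  have hr := (tendsto_rpow_atTop hkR).eventually hx
  obtain ⟨r1, hr1⟩ := eventually_atTop.mp hr
  obtain ⟨ρ, ⟨z0, hz1, hz2, hz3, hz4⟩, hρ⟩ := ((hA f g hf hg hfin).and
    (eventually_ge_atTop (4*(|r1|+|t1|+|y1|+‖f 0‖+B*‖E 0‖+3)))).exists
  have hgr := hy1 ‖z0‖ (by
    have := le_abs_self y1
    linarith [abs_nonneg r1, abs_nonneg t1, norm_nonneg (f 0), mul_nonneg hB hEpos.le]) z0 rfl hz3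
  rw [one_mul, pow_one] at hgr
  set r := ‖g z0‖ with hrdef
  have hrbig : |r1|+|t1|+|y1|+‖f 0‖+B*‖E 0‖+3 ≤ r := by linarith
  have hBE := mul_nonneg hB hEpos.le
  have hf0 := norm_nonneg (f 0)
  have a1 := le_abs_self r1
  have a2 := le_abs_self t1
  have a3 := abs_nonneg r1
  have a4 := abs_nonneg t1
  have a5 := abs_nonneg y1
  have hr3 : 3 ≤ r := by linarith
  obtain ⟨⟨w2, hw2, hw2b⟩, ⟨w', hw1, hw1', hwm, hwk⟩, hxx⟩ := hr1 r (by linarith)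
  set x := r^((1:ℝ)/(2*k:ℕ)) with hxdef
  have hxr : x^(2*k) = r := by
    rw [hxdef, ← Real.rpow_natCast, ← Real.rpow_mul (by linarith), one_div,
      inv_mul_cancel₀ (by positivity), Real.rpow_one]
  have hx0 : 0 ≤ x := Real.rpow_nonneg (by linarith) _
  rw [hxr] at hw2
  set t := ‖f w'‖ with ht
  have htr : r^2 ≤ t := by
    have h1 := hx1 ‖w'‖ (by linarith) w' rfl hwm
    refine le_trans ?_ h1
    rw [← mul_pow, ← hxr, ← pow_mul]
    have : 2*k*2 = 4*k := by ring
    rw [this]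
    exact pow_le_pow_left₀ hx0 (by linarith) _
  have htr' : 1 + r ≤ t := by nlinarith
  have ht0 : 0 < t := by linarith
  have hft : ∀ w, ‖w‖ = r → t < ‖f w‖ := by
    intro w hw
    have h1 := hw2b w' hw1'
    have h2 := hz4 w w2 hw hw2
    exact lt_of_pow_lt_pow_left₀ k (norm_nonneg _) (h1.trans_le h2)
  have hgt : ∀ z, ‖z‖ = t → t^(N+2) ≤ ‖g z‖ := by
    intro z hz
    obtain ⟨m, hm, hmm⟩ := exists_max_point hg.1 ht0
    have h1 := ht1 t (by linarith) m hm hmm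
    have h2 := hwk z m hz hm
    rw [one_mul, mul_comm k, pow_mul] at h1
    exact le_of_pow_le_pow_left₀ (by omega) (norm_nonneg _) (h1.trans h2)
  set U : Set ℂ := {w | ‖w‖ < r ∧ ‖f w‖ < t} with hU
  have hUo : IsOpen U := (isOpen_lt continuous_norm continuous_const).inter
    (isOpen_lt hfc.norm continuous_const)
  have hUb : Bornology.IsBounded U := isBounded_ball.subset (fun w hw => by
    rw [mem_ball_zero_iff]; exact hw.1 : U ⊆ ball 0 r)
  have hcl : closure U ⊆ {w | ‖w‖ ≤ r ∧ ‖f w‖ ≤ t} := by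
    refine closure_minimal (fun w hw => ⟨hw.1.le, hw.2.le⟩) ?_
    exact (isClosed_le continuous_norm continuous_const).inter
      (isClosed_le hfc.norm continuous_const)
  have hmax := Complex.norm_le_of_forall_mem_frontier_norm_le (f := fun w => (E w)⁻¹) (C := B/t)
    (z := 0) hUb (hE.inv hE0).diffContOnCl (by
      intro w hw
      have hw1 : ‖w‖ ≤ r ∧ ‖f w‖ ≤ t := hcl hw.1
      have hw2 : w ∉ U := by
        have := hw.2
        rwa [hUo.interior_eq] at this
      have hlt : ‖w‖ < r := lt_of_le_of_ne hw1.1 (fun h => by linarith [hft w h])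
      have hft' : ‖f w‖ = t := by
        by_contra hcon
        exact hw2 ⟨hlt, lt_of_le_of_ne hw1.2 hcon⟩
      have h1 := hgt _ hft'
      have h2 := norm_sub_norm_le (g (f w)) w
      have h3 : ‖g (f w) - w‖ = ‖P w‖*‖E w‖ := by rw [hPE, norm_mul]
      have h4 := hP w
      have h5 : (1+‖w‖)^N ≤ t^N := pow_le_pow_left₀ (by positivity) (by linarith) _
      have h6 : ‖P w‖ ≤ B*t^N := h4.trans (mul_le_mul_of_nonneg_left h5 hB)
      have h7 : t^N*t ≤ ‖P w‖*‖E w‖ := by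
        rw [← h3]
        have h8 : 1 ≤ t^N := one_le_pow₀ (by linarith)
        have h9 : t^(N+2) = t^N*t*t := by ring
        have h10 : t ≤ t^N*t := by nlinarith
        nlinarith
      have hEw : 0 < ‖E w‖ := norm_pos_iff.mpr (hE0 w)
      have h8 : t^N*t ≤ t^N*(B*‖E w‖) := by
        refine h7.trans ?_
        have := mul_le_mul_of_nonneg_right h6 hEw.le
        linarith
      have h9 := le_of_mul_le_mul_left h8 (by positivity)
      rw [norm_inv, inv_eq_one_div, div_le_div_iff₀ hEw ht0]
      linarith) (subset_closure ⟨by simp; linarith, by linarith⟩)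
  rw [norm_inv, inv_eq_one_div, div_le_div_iff₀ hEpos ht0] at hmax
  linarith

end

/-- **Theorem A.** If `f` and `g` are transcendental entire functions, then
`f ∘ g` has infinitely many fixed points. -/
theorem composite_entire_infinitely_many_fixed_points
    (f g : ℂ → ℂ)
    (hf : Differentiable ℂ f) (hg : Differentiable ℂ g)
    (hf_transc : ¬ ∃ p : Polynomial ℂ, ∀ z : ℂ, f z = p.eval z)
    (hg_transc : ¬ ∃ p : Polynomial ℂ, ∀ z : ℂ, g z = p.eval z) :
    {z : ℂ | f (g z) = z}.Infinite := by
  exact main_thm ⟨hf, hf_transc⟩ ⟨hg, hg_transc⟩
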